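/- Suppose ω(log n) = K = o(√n). Then for any fixed α ∈ (0,1): h⁻¹(log 2 − (log binom(n,K) − O(K^α·log n))/binom(K,2))·binom(K,2) = h⁻¹(log 2 − log binom(n,K)/binom(K,2))·binom(K,2) − O(K^{α+1/2}·√(log n)). -/

import Mathlib

open Filter

noncomputable section

/-- The natural-log binary entropy function. -/
noncomputable def binEnt (x : ℝ) : ℝ := -(x * Real.log x) - (1 - x) * Real.log (1 - x)

/-- The inverse of the binary entropy restricted to `[1/2, 1]`. -/
noncomputable def binEntInv (y : ℝ) : ℝ :=
  Function.invFunOn binEnt (Set.Icc (1/2 : ℝ) 1) y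

open Real in
lemma binEnt_eq_binEntropy (x : ℝ) : binEnt x = binEntropy x := by
  simp only [binEnt, binEntropy, log_inv]
  ring

/-- On `[1/2, 1]`, the entropy drops at least as fast as `2 (x - 1/2) ^ 2`. -/
lemma two_mul_sq_sub_sq_le_binEntropy_sub {x y : ℝ} (hx : 1 / 2 ≤ x) (hxy : x ≤ y) (hy : y ≤ 1) :
    2 * ((y - 1 / 2) ^ 2 - (x - 1 / 2) ^ 2) ≤ Real.binEntropy x - Real.binEntropy y := by
  have hd : ∀ s ∈ Set.Ioo (1 / 2 : ℝ) 1,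
      HasDerivAt (fun s => -Real.binEntropy s - 2 * (s - 1 / 2) ^ 2)
        (-(Real.log (1 - s) - Real.log s) - 4 * (s - 1 / 2)) s := by
    intro s hs
    have h1 := Real.hasDerivAt_binEntropy (p := s) (by linarith [hs.1]) hs.2.ne
    have h2 := (((hasDerivAt_id s).sub_const (1 / 2)).pow 2).const_mul 2
    convert! h1.neg.sub h2 using 1
    simp
    ring
  have hmono : MonotoneOn (fun s => -Real.binEntropy s - 2 * (s - 1 / 2) ^ 2)
      (Set.Icc (1 / 2 : ℝ) 1) := by
    apply monotoneOn_of_deriv_nonneg (convex_Icc _ _)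
    · have := Real.binEntropy_continuous
      fun_prop
    · rw [interior_Icc]
      exact fun s hs => (hd s hs).differentiableAt.differentiableWithinAt
    · rw [interior_Icc]
      intro s hs
      rw [(hd s hs).deriv]
      have hs0 : 0 < s := by linarith [hs.1]
      have hs1 : 0 < 1 - s := by linarith [hs.2]
      have h := Real.le_log_one_add_of_nonneg (x := (2 * s - 1) / (1 - s))
        (div_nonneg (by linarith [hs.1]) hs1.le)
      have e1 : 1 + (2 * s - 1) / (1 - s) = s / (1 - s) := by field_simp; ring
      have e2 : 2 * ((2 * s - 1) / (1 - s)) / ((2 * s - 1) / (1 - s) + 2) = 4 * s - 2 := by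
        have : (2 * s - 1) / (1 - s) + 2 = 1 / (1 - s) := by field_simp; ring
        rw [this]
        field_simp
        ring
      rw [e1, e2, Real.log_div hs0.ne' hs1.ne'] at h
      linarith
  have := hmono ⟨hx, hxy.trans hy⟩ ⟨hx.trans hxy, hy⟩ hxy
  simp only at this
  linarith

lemma log_two_sub_binEntropy_le {y : ℝ} (hy : y ∈ Set.Icc (1 / 2 : ℝ) 1) :
    Real.log 2 - Real.binEntropy y ≤ 4 * (y - 1 / 2) ^ 2 := by
  rcases hy.2.eq_or_lt with rfl | hy1
  · have := Real.log_two_lt_d9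
    norm_num
    linarith
  have hy0 : 0 < y := by linarith [hy.1]
  have hy1' : 0 < 1 - y := by linarith
  have h1 := Real.log_le_sub_one_of_pos (x := 2 * y) (by linarith)
  have h2 := Real.log_le_sub_one_of_pos (x := 2 * (1 - y)) (by linarith)
  rw [Real.log_mul two_ne_zero hy0.ne'] at h1
  rw [Real.log_mul two_ne_zero hy1'.ne'] at h2
  simp only [Real.binEntropy, Real.log_inv]
  nlinarith [mul_le_mul_of_nonneg_left h1 hy0.le, mul_le_mul_of_nonneg_left h2 hy1'.le]

lemma binEntInv_spec {t : ℝ} (h0 : 0 ≤ t) (h1 : t ≤ Real.log 2) :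
    binEntInv t ∈ Set.Icc (1 / 2 : ℝ) 1 ∧ Real.binEntropy (binEntInv t) = t := by
  have hmem : t ∈ binEnt '' Set.Icc (1 / 2 : ℝ) 1 := by
    rw [funext binEnt_eq_binEntropy]
    apply intermediate_value_Icc' (by norm_num) Real.binEntropy_continuous.continuousOn
    rw [one_div, Real.binEntropy_two_inv, Real.binEntropy_one]
    exact ⟨h0, h1⟩
  refine ⟨Function.invFunOn_mem hmem, ?_⟩
  rw [← binEnt_eq_binEntropy]
  exact Function.invFunOn_eq hmem

lemma abs_binEntInv_sub_mul_sqrt_le {a d : ℝ} (hd : 0 ≤ d) (hda : d ≤ a)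
    (ha : a ≤ Real.log 2) :
    |binEntInv (Real.log 2 - (a - d)) - binEntInv (Real.log 2 - a)| * √a ≤ d := by
  obtain ⟨hx, hfx⟩ := binEntInv_spec (t := Real.log 2 - (a - d)) (by linarith) (by linarith)
  obtain ⟨hy, hfy⟩ := binEntInv_spec (t := Real.log 2 - a) (by linarith) (by linarith)
  set x := binEntInv (Real.log 2 - (a - d))
  set y := binEntInv (Real.log 2 - a)
  have hxy : x ≤ y := by
    rw [one_div] at hx hy
    rw [← Real.binEntropy_strictAntiOn.le_iff_ge hy hx]
    linarith
  have hlow := two_mul_sq_sub_sq_le_binEntropy_sub hx.1 hxy hy.2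
  have hup := log_two_sub_binEntropy_le hy
  have hsqrt : √a ≤ 2 * (y - 1 / 2) := by
    apply Real.sqrt_le_iff.2
    constructor
    · linarith [hy.1]
    · nlinarith
  rw [abs_sub_comm, abs_of_nonneg (by linarith)]
  nlinarith [mul_le_mul_of_nonneg_left hsqrt (sub_nonneg.2 hxy),
    mul_nonneg (sub_nonneg.2 hxy) (sub_nonneg.2 hx.1)]

lemma mul_log_div_two_le_log_choose {n k : ℕ} (hk : 0 < k) (hkn : 2 * (k : ℝ) ≤ √n) :
    k * Real.log n / 2 ≤ Real.log (n.choose k) := by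
  have hk' : (1 : ℝ) ≤ k := by exact_mod_cast hk
  have hsq : √(n : ℝ) * √n = n := Real.mul_self_sqrt (Nat.cast_nonneg n)
  have hle : k ≤ n := by
    have : (k : ℝ) ≤ n := by nlinarith
    exact_mod_cast this
  have hs : 0 < √(n : ℝ) := by linarith
  have hpow : √(n : ℝ) ^ k ≤ n.choose k := by
    refine le_trans ?_ (Nat.pow_le_choose k n)
    rw [le_div_iff₀ (by exact_mod_cast k.factorial_pos)]
    calc √(n : ℝ) ^ k * (k.factorial : ℝ) ≤ √(n : ℝ) ^ k * (k : ℝ) ^ k := by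
          gcongr
          exact_mod_cast k.factorial_le_pow
      _ = (√(n : ℝ) * k) ^ k := (mul_pow _ _ _).symm
      _ ≤ ((n + 1 - k : ℕ) : ℝ) ^ k := by
          rw [Nat.cast_sub (by omega)]
          push_cast
          gcongr
          nlinarith
  calc k * Real.log n / 2 = Real.log (√(n : ℝ) ^ k) := by
        rw [Real.log_pow, Real.log_sqrt (Nat.cast_nonneg n)]
        ring
    _ ≤ _ := Real.log_le_log (by positivity) hpow

lemma log_choose_le_mul_log {n k : ℕ} (hkn : k ≤ n) :
    Real.log (n.choose k) ≤ k * Real.log n := by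
  rw [← Real.log_pow]
  apply Real.log_le_log
  · exact_mod_cast Nat.choose_pos hkn
  · exact_mod_cast Nat.choose_le_pow n k

/-- If `ω(log n) = K = o(√n)` and `α ∈ (0,1)` is fixed, then for any
nonnegative sequence `c_n = O(K^α log n)`:
`h⁻¹(log 2 − (log C(n,K) − c_n)/C(K,2))·C(K,2)
  = h⁻¹(log 2 − log C(n,K)/C(K,2))·C(K,2) − O(K^{α+1/2}√(log n))`. -/
theorem binEntInv_perturbation
    (K : ℕ → ℕ) (α : ℝ) (hα : α ∈ Set.Ioo (0 : ℝ) 1)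
    (hKlow : Tendsto (fun n : ℕ => (K n : ℝ) / Real.log n) atTop atTop)
    (hKhigh : Tendsto (fun n : ℕ => (K n : ℝ) / Real.sqrt n) atTop (nhds 0)) :
    ∀ c : ℕ → ℝ, (∀ n, 0 ≤ c n) →
      (∃ M₀ : ℝ, ∀ᶠ n : ℕ in atTop, c n ≤ M₀ * (K n : ℝ) ^ α * Real.log n) →
      ∃ M : ℝ, ∀ᶠ n : ℕ in atTop,
        |binEntInv (Real.log 2 -
              (Real.log (n.choose (K n) : ℝ) - c n) / ((K n).choose 2 : ℝ)) *
            ((K n).choose 2 : ℝ) -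
          binEntInv (Real.log 2 -
              Real.log (n.choose (K n) : ℝ) / ((K n).choose 2 : ℝ)) *
            ((K n).choose 2 : ℝ)| ≤
          M * (K n : ℝ) ^ (α + 1/2) * Real.sqrt (Real.log n) := by
  intro c hc ⟨M₀, hM₀⟩
  refine ⟨M₀, ?_⟩
  have hlog : Tendsto (fun n : ℕ => Real.log n) atTop atTop :=
    Real.tendsto_log_atTop.comp tendsto_natCast_atTop_atTop
  have hK8 : ∀ᶠ n : ℕ in atTop, 8 ≤ (K n : ℝ) / Real.log n := hKlow.eventually_ge_atTop 8
  have hK : Tendsto (fun n : ℕ => (K n : ℝ)) atTop atTop := by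
    refine tendsto_atTop_mono' _ ?_ hlog
    filter_upwards [hK8, hlog.eventually_gt_atTop 0] with n h8 hl
    rw [le_div_iff₀ hl] at h8
    linarith
  have hKpow : ∀ᶠ n : ℕ in atTop, 2 * M₀ ≤ (K n : ℝ) ^ (1 - α) :=
    ((tendsto_rpow_atTop (sub_pos.2 hα.2)).comp hK).eventually_ge_atTop _
  have hKsqrt : ∀ᶠ n : ℕ in atTop, (K n : ℝ) / √n < 1 / 2 :=
    hKhigh.eventually_lt_const (by norm_num)
  filter_upwards [hM₀, hlog.eventually_gt_atTop 0, hK8, hK.eventually_ge_atTop 2, hKpow, hKsqrt,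
    eventually_gt_atTop 0] with n hcn hl h8 h2 hpow hsqrt hn
  have hk0 : (0 : ℝ) < K n := by linarith
  have hs : 0 < √(n : ℝ) := Real.sqrt_pos.2 (by exact_mod_cast hn)
  rw [div_lt_iff₀ hs] at hsqrt
  rw [le_div_iff₀ hl] at h8
  have hkn : K n ≤ n := by
    have h := Real.mul_self_sqrt (Nat.cast_nonneg (α := ℝ) n)
    have : (K n : ℝ) ≤ n := by nlinarith
    exact_mod_cast this
  have hLlow := mul_log_div_two_le_log_choose (n := n) (k := K n) (by exact_mod_cast hk0)
    (by linarith)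
  have hLup := log_choose_le_mul_log hkn
  have hN : ((K n).choose 2 : ℝ) = K n * (K n - 1) / 2 := Nat.cast_choose_two ℝ (K n)
  have hN0 : (0 : ℝ) < (K n).choose 2 := by
    rw [hN]
    have : (0 : ℝ) < K n - 1 := by linarith
    positivity
  set k : ℝ := (K n : ℝ)
  set N : ℝ := ((K n).choose 2 : ℝ)
  set L : ℝ := Real.log (n.choose (K n) : ℝ)
  set l : ℝ := Real.log n
  have hkα : k ^ α * k ^ (1 - α) = k := by
    rw [← Real.rpow_add hk0]
    simp
  have hcL : c n ≤ L := by
    have := mul_le_mul_of_nonneg_left hpow (Real.rpow_nonneg hk0.le α)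
    rw [hkα] at this
    nlinarith
  have ha : L / N ≤ Real.log 2 := by
    rw [div_le_iff₀ hN0, hN]
    have hlog2 := Real.log_two_gt_d9
    have h1 : 2 * l ≤ (k - 1) * Real.log 2 := by nlinarith
    nlinarith
  have halow : l / k ≤ L / N := by
    rw [div_le_div_iff₀ hk0 hN0, hN]
    nlinarith [mul_pos hl hk0]
  have key := abs_binEntInv_sub_mul_sqrt_le (a := L / N) (d := c n / N)
    (div_nonneg (hc n) hN0.le) (by gcongr) ha
  rw [← sub_div] at key
  rw [← sub_mul, abs_mul, abs_of_pos hN0]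
  set D := |binEntInv (Real.log 2 - (L - c n) / N) - binEntInv (Real.log 2 - L / N)|
  have hD : D * N * √(l / k) ≤ M₀ * k ^ α * l := by
    calc D * N * √(l / k) ≤ D * N * √(L / N) := by gcongr
      _ = D * √(L / N) * N := by ring
      _ ≤ c n / N * N := by gcongr
      _ = c n := div_mul_cancel₀ _ hN0.ne'
      _ ≤ _ := hcn
  have hsl : 0 < √l := Real.sqrt_pos.2 hl
  have hsk : 0 < √k := Real.sqrt_pos.2 hk0
  rw [Real.sqrt_div hl.le, ← mul_div_assoc, div_le_iff₀ hsk] at hD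
  rw [Real.rpow_add hk0, ← Real.sqrt_eq_rpow]
  refine le_of_mul_le_mul_right (hD.trans_eq ?_) hsl
  nth_rewrite 1 [← Real.mul_self_sqrt hl.le]
  ring

end
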